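/- Let μ = N(m₀, σ₀²) and ν = N(m₁, σ₁²) be one-dimensional Gaussian measures. Then the squared Gromov–Wasserstein distance with squared-distance cost satisfies GW₂²(μ, ν) = 12(σ₀² − σ₁²)², and it is achieved by the coupling induced by the affine map T(x) = m₁ ± (σ₁/σ₀)(x − m₀) (when σ₀ > 0). -/

import Mathlib

open MeasureTheory ProbabilityTheory

/-- The squared Gromov–Wasserstein "distance" GW₂² between measures on ℝ,
with squared-distance cost. -/
noncomputable def GW2sqR (μ ν : Measure ℝ) : ℝ :=
  ⨅ π : {π : Measure (ℝ × ℝ) // π.map Prod.fst = μ ∧ π.map Prod.snd = ν},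
    ∫ p, ∫ q, (|p.1 - q.1| ^ 2 - |p.2 - q.2| ^ 2) ^ 2 ∂π.1 ∂π.1

lemma gw_deriv (v : ℝ) (a b c d k : ℝ) (t : ℝ) :
    HasDerivAt (fun t : ℝ => (a + b * t + c * t ^ 2 + d * t ^ 3) * Real.exp (v * t ^ 2 / 2))
      ((b + (2 * c + a * v) * t + (3 * d + b * v) * t ^ 2 + c * v * t ^ 3 + d * v * t ^ 4)
        * Real.exp (v * t ^ 2 / 2)) t := by
  have h1 : HasDerivAt (fun t : ℝ => v * t ^ 2 / 2) (v * t) t := by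
    have := (((hasDerivAt_id t).pow 2).const_mul v).div_const 2
    convert! this using 1
    simp; ring
  have h2 : HasDerivAt (fun t : ℝ => a + b * t + c * t ^ 2 + d * t ^ 3)
      (b + 2 * c * t + 3 * d * t ^ 2) t := by
    have := ((((hasDerivAt_id t).const_mul b).const_add a).add
      (((hasDerivAt_id t).pow 2).const_mul c)).add (((hasDerivAt_id t).pow 3).const_mul d)
    convert! this using 1
    simp; ring
  convert! h2.mul h1.exp using 1
  ring

lemma gw_fourth (v : NNReal) : ∫ x, x ^ 4 ∂(gaussianReal 0 v) = 3 * (v : ℝ) ^ 2 := by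
  have h := iteratedDeriv_mgf_zero (X := id) (μ := gaussianReal 0 v)
    (by simp) 4
  have e : mgf id (gaussianReal 0 v) = fun t => Real.exp (v * t ^ 2 / 2) := by
    rw [mgf_id_gaussianReal]; ext t; simp
  have d1 : deriv (fun t => Real.exp ((v : ℝ) * t ^ 2 / 2))
      = fun t => (0 + v * t + 0 * t ^ 2 + 0 * t ^ 3) * Real.exp (v * t ^ 2 / 2) := by
    ext t
    have := (gw_deriv v 1 0 0 0 0 t).deriv
    simp only [zero_mul, add_zero, one_mul] at this
    rw [this]; ring
  have d2 : deriv (fun t => (0 + (v : ℝ) * t + 0 * t ^ 2 + 0 * t ^ 3) * Real.exp (v * t ^ 2 / 2))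
      = fun t => (v + 0 * t + v ^ 2 * t ^ 2 + 0 * t ^ 3) * Real.exp (v * t ^ 2 / 2) := by
    ext t
    rw [(gw_deriv v 0 v 0 0 0 t).deriv]; ring
  have d3 : deriv (fun t => ((v : ℝ) + 0 * t + v ^ 2 * t ^ 2 + 0 * t ^ 3)
        * Real.exp (v * t ^ 2 / 2))
      = fun t => (0 + 3 * v ^ 2 * t + 0 * t ^ 2 + v ^ 3 * t ^ 3) * Real.exp (v * t ^ 2 / 2) := by
    ext t
    rw [(gw_deriv v v 0 (v ^ 2) 0 0 t).deriv]; ring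
  rw [e, iteratedDeriv_succ, iteratedDeriv_succ, iteratedDeriv_succ, iteratedDeriv_one,
    d1, d2, d3, (gw_deriv v 0 (3 * v ^ 2) 0 (v ^ 3) 0 0).deriv] at h
  simp at h
  exact h.symm

lemma gw_key {α : Type*} [MeasurableSpace α] (ρ : Measure α) [IsProbabilityMeasure ρ]
    (f : α → ℝ) (hf : Measurable f) (m : ℝ) (s : NNReal)
    (h : ρ.map f = gaussianReal m (s ^ 2)) :
    Integrable (fun z : α × α => (f z.1 - f z.2) ^ 4) (ρ.prod ρ) ∧
    ∫ z : α × α, (f z.1 - f z.2) ^ 4 ∂(ρ.prod ρ) = 12 * (s : ℝ) ^ 4 := by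
  have hn : ρ.map (fun x => - f x) = gaussianReal (-m) (s ^ 2) := by
    rw [← gaussianReal_map_neg, ← h, Measure.map_map measurable_neg hf]; rfl
  have hi : IndepFun (fun z : α × α => f z.1) (fun z : α × α => - f z.2) (ρ.prod ρ) :=
    indepFun_prod hf hf.neg
  have h1 : (ρ.prod ρ).map (fun z : α × α => f z.1) = gaussianReal m (s ^ 2) := by
    have := Measure.map_map (μ := ρ.prod ρ) (g := f) (f := Prod.fst) hf measurable_fst
    rw [← h]
    refine this.symm.trans ?_
    simp
  have h2 : (ρ.prod ρ).map (fun z : α × α => - f z.2) = gaussianReal (-m) (s ^ 2) := by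
    have := Measure.map_map (μ := ρ.prod ρ) (g := fun x => - f x) (f := Prod.snd) hf.neg
      measurable_snd
    rw [← hn]
    refine this.symm.trans ?_
    simp
  have h3 := gaussianReal_add_gaussianReal_of_indepFun hi h1 h2
  have h4 : (ρ.prod ρ).map (fun z : α × α => f z.1 - f z.2)
      = gaussianReal 0 (s ^ 2 + s ^ 2) := by
    rw [add_neg_cancel] at h3
    rw [← h3]
    congr 1
  have hm : Measurable (fun z : α × α => f z.1 - f z.2) := by fun_prop
  have hint : Integrable (fun x : ℝ => x ^ 4) (gaussianReal 0 (s ^ 2 + s ^ 2)) := by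
    have := (memLp_id_gaussianReal (μ := 0) (v := s ^ 2 + s ^ 2) 4).integrable_norm_pow (p := 4)
      (by norm_num)
    refine this.congr (ae_of_all _ fun x => ?_)
    simp [Even.pow_abs (by decide : Even 4)]
  constructor
  · rw [← h4] at hint
    exact hint.comp_measurable hm
  · have := integral_map (μ := ρ.prod ρ) hm.aemeasurable (f := fun x : ℝ => x ^ 4)
      (by fun_prop)
    rw [← this, h4, gw_fourth]
    push_cast; ring

lemma gw_int {ρ : Measure (ℝ × ℝ)} [IsProbabilityMeasure ρ]
    {m₀ m₁ : ℝ} {s₀ s₁ : NNReal}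
    (h0 : ρ.map Prod.fst = gaussianReal m₀ (s₀ ^ 2))
    (h1 : ρ.map Prod.snd = gaussianReal m₁ (s₁ ^ 2)) :
    Integrable (fun z : (ℝ × ℝ) × (ℝ × ℝ) =>
      (|z.1.1 - z.2.1| ^ 2 - |z.1.2 - z.2.2| ^ 2) ^ 2) (ρ.prod ρ) := by
  obtain ⟨i0, -⟩ := gw_key ρ Prod.fst measurable_fst _ _ h0
  obtain ⟨i1, -⟩ := gw_key ρ Prod.snd measurable_snd _ _ h1
  refine ((i0.add i1).const_mul 2).mono' (by fun_prop) (ae_of_all _ fun z => ?_)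
  rw [Real.norm_of_nonneg (sq_nonneg _)]
  simp only [sq_abs, Pi.add_apply]
  nlinarith [sq_nonneg ((z.1.1 - z.2.1) ^ 2 + (z.1.2 - z.2.2) ^ 2)]

lemma gw_lower {ρ : Measure (ℝ × ℝ)} [IsProbabilityMeasure ρ]
    {m₀ m₁ : ℝ} {s₀ s₁ : NNReal} (hs : 0 < s₀)
    (h0 : ρ.map Prod.fst = gaussianReal m₀ (s₀ ^ 2))
    (h1 : ρ.map Prod.snd = gaussianReal m₁ (s₁ ^ 2)) :
    12 * ((s₀ : ℝ) ^ 2 - (s₁ : ℝ) ^ 2) ^ 2 ≤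
      ∫ p, ∫ q, (|p.1 - q.1| ^ 2 - |p.2 - q.2| ^ 2) ^ 2 ∂ρ ∂ρ := by
  obtain ⟨i0, e0⟩ := gw_key ρ Prod.fst measurable_fst _ _ h0
  obtain ⟨i1, e1⟩ := gw_key ρ Prod.snd measurable_snd _ _ h1
  have hi := gw_int h0 h1
  rw [← integral_prod _ hi]
  have key : ∀ t : ℝ, 0 < t → (1 - t) * (12 * (s₀ : ℝ) ^ 4) + (1 - 1 / t) * (12 * (s₁ : ℝ) ^ 4) ≤
      ∫ z : (ℝ × ℝ) × (ℝ × ℝ), (|z.1.1 - z.2.1| ^ 2 - |z.1.2 - z.2.2| ^ 2) ^ 2 ∂(ρ.prod ρ) := by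
    intro t ht
    rw [← e0, ← e1, ← integral_const_mul, ← integral_const_mul,
      ← integral_add (i0.const_mul _) (i1.const_mul _)]
    refine integral_mono ((i0.const_mul _).add (i1.const_mul _)) hi fun z => ?_
    simp only [sq_abs]
    set A := (z.1.1 - z.2.1)
    set B := (z.1.2 - z.2.2)
    have : 0 ≤ (t * A ^ 2 - B ^ 2) ^ 2 / t := by positivity
    have e : (A ^ 2 - B ^ 2) ^ 2 - ((1 - t) * A ^ 4 + (1 - 1 / t) * B ^ 4)
        = (t * A ^ 2 - B ^ 2) ^ 2 / t := by
      field_simp; ring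
    linarith
  have hs' : (0 : ℝ) < s₀ := by exact_mod_cast hs
  rcases eq_or_ne s₁ 0 with h | h
  · subst h
    refine le_of_forall_pos_le_add fun ε hε => ?_
    have := key (ε / (12 * (s₀ : ℝ) ^ 4)) (by positivity)
    have e : ε / (12 * (s₀ : ℝ) ^ 4) * (12 * (s₀ : ℝ) ^ 4) = ε := by field_simp
    simp only [NNReal.coe_zero] at this ⊢
    nlinarith
  · have h' : (0 : ℝ) < s₁ := by exact_mod_cast pos_iff_ne_zero.mpr h
    refine le_trans (le_of_eq ?_) (key ((s₁ : ℝ) ^ 2 / (s₀ : ℝ) ^ 2) (by positivity))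
    field_simp
    ring

theorem stmt15 (m₀ m₁ : ℝ) (σ₀ σ₁ : NNReal) (hσ₀ : 0 < σ₀) :
    GW2sqR (gaussianReal m₀ (σ₀ ^ 2)) (gaussianReal m₁ (σ₁ ^ 2))
        = 12 * ((σ₀ : ℝ) ^ 2 - (σ₁ : ℝ) ^ 2) ^ 2 ∧
    (∫ p, ∫ q, (|p.1 - q.1| ^ 2 - |p.2 - q.2| ^ 2) ^ 2
        ∂((gaussianReal m₀ (σ₀ ^ 2)).map
            (fun x => (x, m₁ + ((σ₁ : ℝ) / (σ₀ : ℝ)) * (x - m₀))))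
        ∂((gaussianReal m₀ (σ₀ ^ 2)).map
            (fun x => (x, m₁ + ((σ₁ : ℝ) / (σ₀ : ℝ)) * (x - m₀)))))
      = 12 * ((σ₀ : ℝ) ^ 2 - (σ₁ : ℝ) ^ 2) ^ 2 := by
  have hs' : (0 : ℝ) < σ₀ := by exact_mod_cast hσ₀
  set T : ℝ → ℝ × ℝ := fun x => (x, m₁ + ((σ₁ : ℝ) / (σ₀ : ℝ)) * (x - m₀)) with hT
  have hTm : Measurable T := by fun_prop
  set γ := (gaussianReal m₀ (σ₀ ^ 2)).map T with hγ
  have : IsProbabilityMeasure γ := Measure.isProbabilityMeasure_map hTm.aemeasurable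
  have g0 : γ.map Prod.fst = gaussianReal m₀ (σ₀ ^ 2) := by
    rw [hγ, Measure.map_map measurable_fst hTm]
    exact Measure.map_id
  have g1 : γ.map Prod.snd = gaussianReal m₁ (σ₁ ^ 2) := by
    rw [hγ, Measure.map_map measurable_snd hTm]
    have e : (Prod.snd ∘ T) = (fun x => m₁ + x) ∘ (fun x => ((σ₁ : ℝ) / (σ₀ : ℝ)) * x)
        ∘ (fun x => x - m₀) := by
      ext x; rfl
    rw [e, ← Measure.map_map (by fun_prop) (by fun_prop), ← Measure.map_map (by fun_prop) (by fun_prop),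
      gaussianReal_map_sub_const, gaussianReal_map_const_mul, gaussianReal_map_const_add]
    congr 1
    · simp
    · ext; simp; field_simp
  have hcost : (∫ p, ∫ q, (|p.1 - q.1| ^ 2 - |p.2 - q.2| ^ 2) ^ 2 ∂γ ∂γ)
      = 12 * ((σ₀ : ℝ) ^ 2 - (σ₁ : ℝ) ^ 2) ^ 2 := by
    have hi := gw_int g0 g1
    rw [← integral_prod _ hi, hγ, Measure.map_prod_map _ _ hTm hTm, integral_map (by fun_prop) (by fun_prop)]
    have k := (gw_key (gaussianReal m₀ (σ₀ ^ 2)) id measurable_id _ _ Measure.map_id).2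
    have e : ∀ z : ℝ × ℝ, (|(Prod.map T T z).1.1 - (Prod.map T T z).2.1| ^ 2
        - |(Prod.map T T z).1.2 - (Prod.map T T z).2.2| ^ 2) ^ 2
        = (1 - ((σ₁ : ℝ) / σ₀) ^ 2) ^ 2 * (id z.1 - id z.2) ^ 4 := by
      intro z
      simp only [sq_abs, hT, Prod.map_fst, Prod.map_snd, id]
      ring
    simp_rw [e]
    rw [integral_const_mul, k]
    field_simp
  refine ⟨le_antisymm ?_ ?_, hcost⟩
  · rw [← hcost]
    refine ciInf_le (f := fun π : {π : Measure (ℝ × ℝ) // π.map Prod.fst = gaussianReal m₀ (σ₀ ^ 2) ∧ π.map Prod.snd = gaussianReal m₁ (σ₁ ^ 2)} => ∫ p, ∫ q, (|p.1 - q.1| ^ 2 - |p.2 - q.2| ^ 2) ^ 2 ∂π.1 ∂π.1) ⟨0, ?_⟩ ⟨γ, g0, g1⟩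
    rintro _ ⟨π, rfl⟩
    exact integral_nonneg fun p => integral_nonneg fun q => sq_nonneg _
  · have : Nonempty {π : Measure (ℝ × ℝ) // π.map Prod.fst = gaussianReal m₀ (σ₀ ^ 2) ∧ π.map Prod.snd = gaussianReal m₁ (σ₁ ^ 2)} := ⟨⟨γ, g0, g1⟩⟩
    refine le_ciInf fun π => ?_
    obtain ⟨ρ, r0, r1⟩ := π
    have : IsProbabilityMeasure ρ := by
      refine ⟨?_⟩
      have : (ρ.map Prod.fst) Set.univ = 1 := by rw [r0]; exact measure_univ
      rwa [Measure.map_apply measurable_fst MeasurableSet.univ, Set.preimage_univ] at this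
    exact gw_lower hσ₀ r0 r1
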